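/- arXiv:1302.3044 — 5 statements merged into one kernel-verified Lean document; each statement's English description precedes it below -/
import Mathlib

section
/- Let H be a group with no divisors of zero whose center C(H) is nontrivial. Then for every nontrivial element y ∈ H there exists a positive integer n such that y^n ≠ 1 and y^n belongs to the center C(H). -/
/-- A group `H` has no divisors of zero: there are no nontrivial `x, y` with
`⟨x⟩ ⊓ ⟨y⟩ = ⊥` and `x` commuting with `y`. -/
def GroupHasNoZeroDivisors (H : Type*) [Group H] : Prop :=
  ¬ ∃ x y : H, x ≠ 1 ∧ y ≠ 1 ∧ Subgroup.zpowers x ⊓ Subgroup.zpowers y = ⊥ ∧ Commute x y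

theorem stmt_6 {H : Type*} [Group H] (hH : GroupHasNoZeroDivisors H)
    (hc : Subgroup.center H ≠ ⊥) :
    ∀ y : H, y ≠ 1 → ∃ n : ℕ, 0 < n ∧ y ^ n ≠ 1 ∧ y ^ n ∈ Subgroup.center H := by
  intro y hy
  obtain ⟨z, hz, hz1⟩ := (Subgroup.bot_or_exists_ne_one _).resolve_left hc
  have hne : Subgroup.zpowers z ⊓ Subgroup.zpowers y ≠ ⊥ := fun h =>
    hH ⟨z, y, hz1, hy, h, (Subgroup.mem_center_iff.1 hz y).symm⟩
  obtain ⟨w, ⟨hwz, hwy⟩, hw1⟩ := (Subgroup.bot_or_exists_ne_one _).resolve_left hne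
  have hwc : w ∈ Subgroup.center H := Subgroup.zpowers_le.2 hz hwz
  obtain ⟨k, rfl⟩ := Subgroup.mem_zpowers_iff.1 hwy
  refine ⟨k.natAbs, Int.natAbs_pos.2 ?_, ?_, ?_⟩
  · rintro rfl
    exact hw1 (zpow_zero y)
  · rwa [Ne, pow_natAbs_eq_one]
  · rcases Int.natAbs_eq k with h | h <;> rw [h] at hwc <;>
      simpa only [zpow_neg, inv_mem_iff, zpow_natCast] using hwc
end

section
/- Let H be a group with no divisors of zero whose center C(H) is nontrivial and finite. Then every element of H has finite order, and the order of every nontrivial element of H is a power p^n of some prime p. -/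
theorem GroupHasNoZeroDivisors.not_disjoint_zpowers {H : Type*} [Group H]
    (hH : GroupHasNoZeroDivisors H) {x y : H} (hx : x ≠ 1) (hy : y ≠ 1) (hxy : Commute x y) :
    Subgroup.zpowers x ⊓ Subgroup.zpowers y ≠ ⊥ :=
  fun h => hH ⟨x, y, hx, hy, h, hxy⟩

theorem GroupHasNoZeroDivisors.isOfFinOrder_of_commute {H : Type*} [Group H]
    (hH : GroupHasNoZeroDivisors H) {x z : H} (hz : z ≠ 1) (hzfin : IsOfFinOrder z)
    (hxz : Commute x z) : IsOfFinOrder x := by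
  by_cases hx : x = 1
  · exact hx ▸ IsOfFinOrder.one
  obtain ⟨⟨w, ⟨k, hk⟩, hwz⟩, hw⟩ :=
    Subgroup.ne_bot_iff_exists_ne_one.mp (hH.not_disjoint_zpowers hx hz hxz)
  have hwfin : IsOfFinOrder (x ^ k) := by
    obtain ⟨m, hm⟩ := hwz
    simpa only [hk, ← hm] using hzfin.zpow (i := m)
  have hk0 : k ≠ 0 := by
    rintro rfl
    exact hw (Subtype.ext (by simpa using hk.symm))
  rw [isOfFinOrder_iff_zpow_eq_one] at hwfin ⊢
  obtain ⟨n, hn, hxn⟩ := hwfin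
  exact ⟨k * n, mul_ne_zero hk0 hn, by rw [zpow_mul, hxn]⟩

theorem GroupHasNoZeroDivisors.exists_orderOf_eq_prime_pow {H : Type*} [Group H]
    (hH : GroupHasNoZeroDivisors H) {x : H} (hx : x ≠ 1) (hfin : IsOfFinOrder x) :
    ∃ p n : ℕ, p.Prime ∧ 0 < n ∧ orderOf x = p ^ n := by
  have hpos : 0 < orderOf x := hfin.orderOf_pos
  have hne : orderOf x ≠ 1 := fun h => hx (orderOf_eq_one_iff.mp h)
  have hp : (orderOf x).minFac.Prime := Nat.minFac_prime hne
  have hdvd : (orderOf x).minFac ∣ orderOf x := Nat.minFac_dvd _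
  generalize (orderOf x).minFac = p at hp hdvd
  obtain ⟨k, m, hpm, hkm⟩ := Nat.exists_eq_pow_mul_and_not_dvd hpos.ne' p hp.ne_one
  have hk : k ≠ 0 := by
    rintro rfl
    exact hpm (by simpa [hkm] using hdvd)
  refine ⟨p, k, hp, Nat.pos_of_ne_zero hk, ?_⟩
  by_contra hpow
  have hm : m ≠ 1 := fun h => hpow (by simpa [h] using hkm)
  have hpk : p ^ k ≠ 1 := (Nat.one_lt_pow hk hp.one_lt).ne'
  have hm0 : m ≠ 0 := fun h => hpm (h ▸ dvd_zero p)
  have hordm : orderOf (x ^ m) = p ^ k := by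
    rw [orderOf_pow_of_dvd hm0 (hkm ▸ dvd_mul_left _ _), hkm,
      Nat.mul_div_cancel _ (Nat.pos_of_ne_zero hm0)]
  have hpk0 : p ^ k ≠ 0 := pow_ne_zero _ hp.ne_zero
  have hordpk : orderOf (x ^ p ^ k) = m := by
    rw [orderOf_pow_of_dvd hpk0 (hkm ▸ dvd_mul_right _ _), hkm,
      Nat.mul_div_cancel_left _ (Nat.pos_of_ne_zero hpk0)]
  refine hH.not_disjoint_zpowers (x := x ^ m) (y := x ^ p ^ k) ?_ ?_
    ((Commute.refl x).pow_pow _ _) (Subgroup.disjoint_of_coprime_natCard ?_).eq_bot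
  · rwa [Ne, ← orderOf_eq_one_iff, hordm]
  · rwa [Ne, ← orderOf_eq_one_iff, hordpk]
  · rw [Nat.card_zpowers, Nat.card_zpowers, hordm, hordpk]
    exact ((Nat.Prime.coprime_iff_not_dvd hp).mpr hpm).pow_left k

theorem stmt_7 {H : Type*} [Group H] (hH : GroupHasNoZeroDivisors H)
    (hc : Subgroup.center H ≠ ⊥) (hfin : Finite (Subgroup.center H)) :
    (∀ x : H, IsOfFinOrder x) ∧
    (∀ x : H, x ≠ 1 → ∃ p n : ℕ, p.Prime ∧ 0 < n ∧ orderOf x = p ^ n) := by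
  obtain ⟨⟨z, hzc⟩, hz⟩ := Subgroup.ne_bot_iff_exists_ne_one.mp hc
  have hz1 : z ≠ 1 := fun h => hz (Subtype.ext h)
  have hzfin : IsOfFinOrder z :=
    Submonoid.isOfFinOrder_coe.mpr (isOfFinOrder_of_finite (⟨z, hzc⟩ : Subgroup.center H))
  have hall : ∀ x : H, IsOfFinOrder x := fun x =>
    hH.isOfFinOrder_of_commute hz1 hzfin (Subgroup.mem_center_iff.mp hzc x)
  exact ⟨hall, fun x hx => hH.exists_orderOf_eq_prime_pow hx (hall x)⟩
end

section
/- Let H be a nontrivial finitely generated nilpotent group with no divisors of zero. Then H is finite or H is isomorphic to ℤ. -/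
/-- A torsion finitely generated group has all terms of its derived series of finite index. -/
theorem finiteIndex_derivedSeries_of_fg_of_isMulTorsion {G : Type*} [Group G] [Group.FG G]
    (hG : IsMulTorsion G) (n : ℕ) : (derivedSeries G n).FiniteIndex := by
  induction n with
  | zero => rw [derivedSeries_zero]; infer_instance
  | succ n ih =>
    set D := derivedSeries G n
    have hfg : Group.FG (Abelianization D) :=
      Group.fg_of_surjective (f := Abelianization.of) (QuotientGroup.mk'_surjective _)
    have hfin : Finite (D ⧸ commutator D) :=
      CommGroup.finite_of_fg_isMulTorsion (Abelianization D)
        ((hG.subgroup D).of_surjective (f := Abelianization.of) (QuotientGroup.mk'_surjective _))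
    have hcomm : (commutator D).index ≠ 0 :=
      (Subgroup.finiteIndex_of_finite_quotient (H := commutator D)).index_ne_zero
    constructor
    rw [derivedSeries_succ, ← Subgroup.map_subtype_commutator, Subgroup.index_map_subtype]
    exact mul_ne_zero hcomm ih.index_ne_zero

theorem Group.IsSolvable.finite_of_fg_of_isMulTorsion {G : Type*} [Group G] [Group.FG G]
    [Group.IsSolvable G] (hG : IsMulTorsion G) : Finite G := by
  obtain ⟨n, hn⟩ := Group.IsSolvable.solvable (G := G)
  have h := finiteIndex_derivedSeries_of_fg_of_isMulTorsion hG n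
  rw [hn] at h
  exact Nat.finite_of_card_ne_zero (Subgroup.index_bot (G := G) ▸ h.index_ne_zero)

/-- A group in which no nontrivial element is killed by the index of some central cyclic subgroup
of finite index is cyclic. -/
theorem isCyclic_of_zpowers_finiteIndex {G : Type*} [Group G] {z : G}
    (hz : z ∈ Subgroup.center G) [(Subgroup.zpowers z).FiniteIndex]
    (htf : ∀ x : G, x ^ (Subgroup.zpowers z).index = 1 → x = 1) : IsCyclic G := by
  have hle : Subgroup.zpowers z ≤ Subgroup.center G := by simpa using hz
  let _ : CommGroup (Subgroup.zpowers z) := IsCyclic.commGroup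
  refine isCyclic_of_injective (MonoidHom.transfer (MonoidHom.id (Subgroup.zpowers z)))
    ((injective_iff_map_eq_one _).2 fun x hx => htf x ?_)
  rw [MonoidHom.transfer_eq_pow _ x fun k g hk => by
    rw [← mul_right_inj, ← (hle hk).comm, mul_inv_cancel_right]] at hx
  exact congrArg Subtype.val hx

theorem GroupHasNoZeroDivisors.exists_zpow_mem_zpowers {H : Type*} [Group H]
    (hH : GroupHasNoZeroDivisors H) {x z : H} (hx : x ≠ 1) (hz : z ≠ 1) (hxz : Commute x z) :
    ∃ k : ℤ, x ^ k ≠ 1 ∧ x ^ k ∈ Subgroup.zpowers z := by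
  by_contra! h
  refine hH ⟨x, z, hx, hz, (Subgroup.eq_bot_iff_forall _).2 ?_, hxz⟩
  rintro _ ⟨⟨k, rfl⟩, hk⟩
  by_contra hne
  exact h k hne hk

theorem stmt_8 {H : Type*} [Group H] [Nontrivial H] (hfg : Group.FG H)
    (hnilp : Group.IsNilpotent H) (hH : GroupHasNoZeroDivisors H) :
    Finite H ∨ Nonempty (H ≃* Multiplicative ℤ) := by
  obtain ⟨⟨z, hzc⟩, hz⟩ :=
    Subgroup.ne_bot_iff_exists_ne_one.1 (Group.IsNilpotent.center_ne_bot (G := H))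
  replace hz : z ≠ 1 := fun h => hz (Subtype.ext h)
  have hpow {x : H} (hx : x ≠ 1) :=
    hH.exists_zpow_mem_zpowers hx hz (Subgroup.mem_center_iff.1 hzc x)
  have : (Subgroup.zpowers z).Normal := ⟨fun n hn g => by
    have hnc : n ∈ Subgroup.center H := (Subgroup.zpowers_le (H := Subgroup.center H)).2 hzc hn
    rwa [Subgroup.mem_center_iff.1 hnc g, mul_inv_cancel_right]⟩
  have htor : IsMulTorsion (H ⧸ Subgroup.zpowers z) := by
    intro q
    obtain ⟨x, rfl⟩ := QuotientGroup.mk_surjective q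
    rcases eq_or_ne x 1 with rfl | hx
    · exact IsOfFinOrder.one
    obtain ⟨k, hk1, hk⟩ := hpow hx
    refine isOfFinOrder_iff_zpow_eq_one.2 ⟨k, fun h => hk1 (by simp [h]), ?_⟩
    rwa [← QuotientGroup.mk_zpow, QuotientGroup.eq_one_iff]
  have hquot : Finite (H ⧸ Subgroup.zpowers z) :=
    Group.IsSolvable.finite_of_fg_of_isMulTorsion htor
  have hindex : (Subgroup.zpowers z).FiniteIndex := Subgroup.finiteIndex_of_finite_quotient
  by_cases hfin : Finite H
  · exact Or.inl hfin
  have hzinf : ¬ IsOfFinOrder z := fun h => hfin <| by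
    have : Finite (Subgroup.zpowers z) := h.finite_zpowers
    exact Finite.of_subgroup_quotient (Subgroup.zpowers z)
  have hcyc : IsCyclic H := isCyclic_of_zpowers_finiteIndex hzc fun x hxn => by
    by_contra hx
    obtain ⟨k, hk1, m, hm : z ^ m = x ^ k⟩ := hpow hx
    refine hzinf (isOfFinOrder_iff_zpow_eq_one.2 ⟨m * (Subgroup.zpowers z).index, ?_, ?_⟩)
    · refine mul_ne_zero (fun h => hk1 (by rw [← hm, h, zpow_zero])) ?_
      exact_mod_cast hindex.index_ne_zero
    · rw [zpow_mul, hm, ← zpow_mul, mul_comm, zpow_mul, zpow_natCast, hxn, one_zpow]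
  have : Infinite H := not_finite_iff_infinite.1 hfin
  have e := zmodCyclicMulEquiv hcyc
  rw [Nat.card_eq_zero_of_infinite] at e
  exact Or.inr ⟨e.symm⟩
end

section
/- Let H be a finitely generated commutative group and let I be a proper subgroup of H. Then the quotient H/I has no divisors of zero if and only if H/I is isomorphic to ℤ or to ℤ/p^n for some prime p and integer n ≥ 1. -/
/-- In a commutative group without divisors of zero, a retraction onto a nontrivial group is
injective. -/
lemma GroupHasNoZeroDivisors.injective_of_rightInverse {G K : Type*} [CommGroup G] [Group K]
    [Nontrivial K] (hG : GroupHasNoZeroDivisors G) (f : G →* K) (s : K →* G)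
    (hfs : Function.RightInverse s f) : Function.Injective f := by
  rw [injective_iff_map_eq_one]
  intro y hy
  by_contra hy1
  obtain ⟨k, hk⟩ := exists_ne (1 : K)
  refine hG ⟨s k, y, fun h => hk ?_, hy1, ?_, Commute.all _ _⟩
  · rw [← hfs k, h, map_one]
  · rw [eq_bot_iff]
    rintro z ⟨⟨a, rfl⟩, ⟨b, hb⟩⟩
    have hz := congrArg f hb
    simp only [map_zpow, hy, one_zpow, hfs k] at hz
    simp [← map_zpow, ← hz]

lemma GroupHasNoZeroDivisors.nonempty_mulEquiv_of_rightInverse {G K : Type*} [CommGroup G]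
    [Group K] [Nontrivial K] (hG : GroupHasNoZeroDivisors G) (f : G →* K) (s : K →* G)
    (hfs : Function.RightInverse s f) : Nonempty (G ≃* K) :=
  ⟨MulEquiv.ofBijective f ⟨hG.injective_of_rightInverse f s hfs, hfs.surjective⟩⟩

lemma GroupHasNoZeroDivisors.of_mulEquiv {G K : Type*} [Group G] [Group K] (e : G ≃* K)
    (hK : GroupHasNoZeroDivisors K) : GroupHasNoZeroDivisors G := by
  rintro ⟨x, y, hx, hy, hxy, hc⟩
  refine hK ⟨e x, e y, by simpa using hx, by simpa using hy, ?_, hc.map e⟩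
  have hmap (g : G) : Subgroup.zpowers (e g) = (Subgroup.zpowers g).map e.toMonoidHom :=
    (MonoidHom.map_zpowers e.toMonoidHom g).symm
  rw [hmap, hmap, ← Subgroup.map_inf _ _ _ e.injective, hxy, Subgroup.map_bot]

lemma zpow_eq_one_of_zpowers_inf_eq_bot {G : Type*} [Group G] {x y : G}
    (h : Subgroup.zpowers x ⊓ Subgroup.zpowers y = ⊥) {a b : ℤ} (hab : x ^ a = y ^ b) :
    x ^ a = 1 := by
  have hmem : x ^ a ∈ Subgroup.zpowers x ⊓ Subgroup.zpowers y := ⟨⟨a, rfl⟩, ⟨b, hab.symm⟩⟩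
  rwa [h, Subgroup.mem_bot] at hmem

lemma groupHasNoZeroDivisors_multiplicative_int :
    GroupHasNoZeroDivisors (Multiplicative ℤ) := by
  rintro ⟨x, y, hx, hy, hxy, -⟩
  have h := zpow_eq_one_of_zpowers_inf_eq_bot hxy (a := y.toAdd) (b := x.toAdd)
    (by apply Multiplicative.toAdd.injective; simp [mul_comm])
  have h' := congrArg Multiplicative.toAdd h
  simp only [toAdd_zpow, smul_eq_mul, toAdd_one, mul_eq_zero, toAdd_eq_zero] at h'
  exact h'.elim hy hx

lemma IsCyclic.zpowers_le_zpowers_of_orderOf_dvd {G : Type*} [CommGroup G] [IsCyclic G] [Finite G]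
    {x y : G} (h : orderOf x ∣ orderOf y) : Subgroup.zpowers x ≤ Subgroup.zpowers y := by
  have hker : Subgroup.zpowers y = (powMonoidHom (orderOf y) : G →* G).ker := by
    refine Subgroup.eq_of_le_of_card_ge ?_ ?_
    · simp [MonoidHom.mem_ker, pow_orderOf_eq_one]
    · rw [IsCyclic.card_powMonoidHom_ker, Nat.card_zpowers,
        Nat.gcd_eq_right (orderOf_dvd_natCard y)]
  rw [hker, Subgroup.zpowers_le, MonoidHom.mem_ker]
  exact orderOf_dvd_iff_pow_eq_one.mp h

lemma groupHasNoZeroDivisors_multiplicative_zmod_prime_pow {p : ℕ} (hp : p.Prime) (n : ℕ) :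
    GroupHasNoZeroDivisors (Multiplicative (ZMod (p ^ n))) := by
  have : NeZero (p ^ n) := ⟨pow_ne_zero _ hp.ne_zero⟩
  have key (x y : Multiplicative (ZMod (p ^ n)))
      (hxy : Subgroup.zpowers x ⊓ Subgroup.zpowers y = ⊥) (h : orderOf x ∣ orderOf y) :
      x = 1 := by
    rwa [inf_eq_left.mpr (IsCyclic.zpowers_le_zpowers_of_orderOf_dvd h), Subgroup.zpowers_eq_bot] at hxy
  rintro ⟨x, y, hx, hy, hxy, -⟩
  have hord (z : Multiplicative (ZMod (p ^ n))) : ∃ k ≤ n, orderOf z = p ^ k := by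
    rw [← Nat.dvd_prime_pow hp]
    simpa using orderOf_dvd_natCard z
  obtain ⟨a, -, ha⟩ := hord x
  obtain ⟨b, -, hb⟩ := hord y
  rcases le_total a b with hab | hab
  · exact hx (key x y hxy (ha ▸ hb ▸ pow_dvd_pow p hab))
  · exact hy (key y x (by rwa [inf_comm]) (ha ▸ hb ▸ pow_dvd_pow p hab))

theorem stmt_10 {H : Type*} [CommGroup H] (hfg : Group.FG H)
    (I : Subgroup H) (hI : I ≠ ⊤) :
    GroupHasNoZeroDivisors (H ⧸ I) ↔
      Nonempty ((H ⧸ I) ≃* Multiplicative ℤ) ∨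
      ∃ p n : ℕ, p.Prime ∧ 1 ≤ n ∧ Nonempty ((H ⧸ I) ≃* Multiplicative (ZMod (p ^ n))) := by
  classical
  constructor
  · intro hG
    obtain ⟨ι, j, _, _, p, hp, e, ⟨φ⟩⟩ :=
      CommGroup.equiv_free_prod_prod_multiplicative_zmod (H ⧸ I)
    rcases isEmpty_or_nonempty j with hj | ⟨⟨k⟩⟩
    · right
      by_cases he : ∃ i, e i ≠ 0
      · obtain ⟨i, hi⟩ := he
        have : Fact (1 < p i ^ e i) := ⟨Nat.one_lt_pow hi (hp i).one_lt⟩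
        exact ⟨p i, e i, hp i, Nat.one_le_iff_ne_zero.mpr hi,
          hG.nonempty_mulEquiv_of_rightInverse
            (((Pi.evalMonoidHom _ i).comp (MonoidHom.snd _ _)).comp φ.toMonoidHom)
            (φ.symm.toMonoidHom.comp ((MonoidHom.inr _ _).comp
              (MonoidHom.mulSingle (fun i => Multiplicative (ZMod (p i ^ e i))) i)))
            fun z => by simp⟩
      · push Not at he
        have (i : ι) : Subsingleton (Multiplicative (ZMod (p i ^ e i))) := by
          rw [he i, pow_zero]
          exact inferInstanceAs (Subsingleton (ZMod 1))
        have := φ.toEquiv.subsingleton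
        exact absurd (QuotientGroup.subgroup_eq_top_of_subsingleton I this) hI
    · left
      exact hG.nonempty_mulEquiv_of_rightInverse
        (((Pi.evalMonoidHom _ k).comp (MonoidHom.fst _ _)).comp φ.toMonoidHom)
        (φ.symm.toMonoidHom.comp ((MonoidHom.inl _ _).comp
          (MonoidHom.mulSingle (fun _ => Multiplicative ℤ) k)))
        fun z => by simp
  · rintro (⟨⟨φ⟩⟩ | ⟨p, n, hp, -, ⟨φ⟩⟩)
    · exact groupHasNoZeroDivisors_multiplicative_int.of_mulEquiv φ
    · exact (groupHasNoZeroDivisors_multiplicative_zmod_prime_pow hp n).of_mulEquiv φ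
end

section
/- Let G and H be two groups, each with no divisors of zero. Then the free product G ∗ H has no divisors of zero. -/
namespace Monoid.CoprodI

section Reduced

variable {ι : Type*} {M : ι → Type*} [∀ i, Group (M i)]

/-- The element of the free product spelled by a list of letters. -/
def listProd (L : List (Σ i, M i)) : CoprodI M :=
  (L.map fun s => of s.2).prod

/-- A list of letters is reduced if no letter is trivial and neighbouring letters come from
different factors. -/
def IsReduced (L : List (Σ i, M i)) : Prop :=
  (∀ s ∈ L, s.2 ≠ 1) ∧ L.IsChain fun s t => s.1 ≠ t.1

/-- The formal inverse of a list of letters. -/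
def listInv (L : List (Σ i, M i)) : List (Σ i, M i) :=
  (L.map fun s => ⟨s.1, s.2⁻¹⟩).reverse

@[simp]
theorem listProd_nil : listProd ([] : List (Σ i, M i)) = 1 := rfl

@[simp]
theorem listProd_cons (s : Σ i, M i) (L : List (Σ i, M i)) :
    listProd (s :: L) = of s.2 * listProd L := by
  simp [listProd]

@[simp]
theorem listProd_append (L₁ L₂ : List (Σ i, M i)) :
    listProd (L₁ ++ L₂) = listProd L₁ * listProd L₂ := by
  simp [listProd]

@[simp]
theorem listProd_flatten_replicate (n : ℕ) (L : List (Σ i, M i)) :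
    listProd (List.replicate n L).flatten = listProd L ^ n := by
  induction n with
  | zero => simp
  | succ n ih => simp [List.replicate_succ, ih, pow_succ']

@[simp]
theorem listProd_listInv (L : List (Σ i, M i)) : listProd (listInv L) = (listProd L)⁻¹ := by
  induction L with
  | nil => simp [listInv]
  | cons s L ih =>
    have h : listInv (s :: L) = listInv L ++ [⟨s.1, s.2⁻¹⟩] := by simp [listInv]
    simp [h, ih]

theorem isReduced_nil : IsReduced ([] : List (Σ i, M i)) := by
  simp [IsReduced]

theorem isReduced_append {L₁ L₂ : List (Σ i, M i)} :
    IsReduced (L₁ ++ L₂) ↔ IsReduced L₁ ∧ IsReduced L₂ ∧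
      ∀ s ∈ L₁.getLast?, ∀ t ∈ L₂.head?, s.1 ≠ t.1 := by
  simp only [IsReduced, List.isChain_append, List.mem_append]
  grind

theorem isReduced_cons {s : Σ i, M i} {L : List (Σ i, M i)} :
    IsReduced (s :: L) ↔ s.2 ≠ 1 ∧ IsReduced L ∧ ∀ t ∈ L.head?, s.1 ≠ t.1 := by
  simp only [IsReduced, List.isChain_cons, List.mem_cons]
  grind

theorem IsReduced.listInv {L : List (Σ i, M i)} (hL : IsReduced L) : IsReduced (listInv L) := by
  refine ⟨?_, ?_⟩
  · intro s hs
    simp only [CoprodI.listInv, List.mem_reverse, List.mem_map] at hs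
    obtain ⟨t, ht, rfl⟩ := hs
    simpa using hL.1 t ht
  · rw [CoprodI.listInv, List.isChain_reverse, List.isChain_map]
    exact hL.2.imp fun _ _ h => h.symm

theorem IsReduced.listProd_inj {L₁ L₂ : List (Σ i, M i)} (h₁ : IsReduced L₁) (h₂ : IsReduced L₂)
    (h : listProd L₁ = listProd L₂) : L₁ = L₂ := by
  classical
  exact congrArg Word.toList (Word.equiv.symm.injective
    (a₁ := (⟨L₁, h₁.1, h₁.2⟩ : Word M)) (a₂ := ⟨L₂, h₂.1, h₂.2⟩) h)

/-- A list of letters is either reduced, or its product is spelled by a shorter reduced list. -/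
theorem exists_isReduced (L : List (Σ i, M i)) :
    ∃ L' : List (Σ i, M i), IsReduced L' ∧ listProd L' = listProd L ∧
      (L' = L ∨ L'.length < L.length) := by
  induction L with
  | nil => exact ⟨[], isReduced_nil, rfl, Or.inl rfl⟩
  | cons s L ih =>
    obtain ⟨L', hred, hprod, hlen⟩ := ih
    have hle : L'.length ≤ L.length := by grind
    by_cases hs : s.2 = 1
    · exact ⟨L', hred, by simp [hs, hprod], Or.inr (by grind)⟩
    by_cases hhead : ∀ t ∈ L'.head?, s.1 ≠ t.1
    · refine ⟨s :: L', isReduced_cons.2 ⟨hs, hred, hhead⟩, by simp [hprod], ?_⟩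
      grind
    · obtain ⟨i, a⟩ := s
      match L', hred, hprod, hlen, hle, hhead with
      | [], _, _, _, _, hhead => simp at hhead
      | ⟨j, b⟩ :: T, hred, hprod, _, hle, hhead =>
        obtain rfl : i = j := by simpa using hhead
        rw [isReduced_cons] at hred
        by_cases hab : a * b = 1
        · refine ⟨T, hred.2.1, ?_, Or.inr (by grind)⟩
          rw [listProd_cons, ← hprod, listProd_cons, ← mul_assoc, ← map_mul]
          simp [hab]
        · refine ⟨⟨i, a * b⟩ :: T, isReduced_cons.2 ⟨hab, hred.2⟩, ?_, Or.inr (by grind)⟩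
          rw [listProd_cons, listProd_cons, ← hprod, listProd_cons, ← mul_assoc, ← map_mul]

theorem IsReduced.eq_of_length_le {L₁ L₂ : List (Σ i, M i)} (h₁ : IsReduced L₁)
    (h : listProd L₁ = listProd L₂) (hlen : L₂.length ≤ L₁.length) : L₁ = L₂ := by
  obtain ⟨L, hred, hprod, hL⟩ := exists_isReduced L₂
  obtain rfl := h₁.listProd_inj hred (h.trans hprod.symm)
  grind

theorem exists_isReduced_listProd_eq (x : CoprodI M) :
    ∃ L : List (Σ i, M i), IsReduced L ∧ listProd L = x := by
  have h : ∃ L : List (Σ i, M i), listProd L = x := by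
    induction x using CoprodI.induction_on with
    | one => exact ⟨[], rfl⟩
    | of i m => exact ⟨[⟨i, m⟩], by simp⟩
    | mul x y hx hy =>
      obtain ⟨⟨L₁, rfl⟩, ⟨L₂, rfl⟩⟩ := hx, hy
      exact ⟨L₁ ++ L₂, by simp⟩
  obtain ⟨L, rfl⟩ := h
  obtain ⟨L', hred, hprod, -⟩ := exists_isReduced L
  exact ⟨L', hred, hprod⟩

/-- The centralizer of a nontrivial element of a factor is contained in that factor. -/
theorem mem_range_of_of_commute {i : ι} {a : M i} (ha : a ≠ 1) {y : CoprodI M}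
    (h : Commute (of a) y) : ∃ b : M i, y = of b := by
  obtain ⟨b, T, hT, hhead, rfl⟩ : ∃ (b : M i) (T : List (Σ i, M i)), IsReduced T ∧
      (∀ t ∈ T.head?, i ≠ t.1) ∧ y = of b * listProd T := by
    obtain ⟨L, hL, rfl⟩ := exists_isReduced_listProd_eq y
    by_cases hhead : ∀ t ∈ L.head?, i ≠ t.1
    · exact ⟨1, L, hL, hhead, by simp⟩
    · match L, hL, hhead with
      | [], _, hhead => simp at hhead
      | ⟨j, b⟩ :: T, hL, hhead =>
        obtain rfl : i = j := by simpa using hhead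
        rw [isReduced_cons] at hL
        exact ⟨b, T, hL.2.1, hL.2.2, by simp⟩
  have hne : b⁻¹ * a * b ≠ 1 := fun h1 => ha (by
    rw [mul_assoc, inv_mul_eq_one] at h1
    simpa using h1.symm)
  have heq : listProd (⟨i, b⁻¹ * a * b⟩ :: T) = listProd (T ++ [⟨i, a⟩]) := by
    simp only [listProd_cons, listProd_append, listProd_nil, mul_one, map_mul, map_inv]
    rw [mul_assoc, mul_assoc, inv_mul_eq_iff_eq_mul, h.eq, mul_assoc]
  have hlist := (isReduced_cons.2 ⟨hne, hT, hhead⟩).eq_of_length_le heq (by simp)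
  match T, hhead, hlist with
  | [], _, _ => exact ⟨b, by simp⟩
  | t :: T, hhead, hlist =>
    rw [List.cons_append, List.cons.injEq] at hlist
    exact absurd (congrArg Sigma.fst hlist.1) (hhead t rfl)

theorem IsReduced.append_flatten_replicate {X Y : List (Σ i, M i)} (hX : IsReduced (X ++ X))
    (hYX : IsReduced (Y ++ X)) (n : ℕ) : IsReduced (Y ++ (List.replicate n X).flatten) := by
  induction n generalizing Y with
  | zero => simpa using (isReduced_append.1 hYX).1
  | succ n ih =>
    rw [List.replicate_succ, List.flatten_cons, ← List.append_assoc]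
    apply ih
    rcases List.eq_nil_or_concat X with rfl | ⟨X', s, rfl⟩
    · simpa using hYX
    · rw [isReduced_append]
      refine ⟨hYX, (isReduced_append.1 hX).1, ?_⟩
      simpa using (isReduced_append.1 hX).2.2

theorem exists_of_prefix_flatten_replicate {α : Type*} {X Y : List α} {n : ℕ}
    (h : Y <+: (List.replicate n X).flatten) :
    ∃ (k : ℕ) (P : List α), P <+: X ∧ Y = (List.replicate k X).flatten ++ P := by
  induction n generalizing Y with
  | zero => exact ⟨0, [], List.nil_prefix, by simpa using h⟩
  | succ n ih =>
    rw [List.replicate_succ, List.flatten_cons] at h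
    rcases List.prefix_or_prefix_of_prefix h (List.prefix_append X _) with hYX | ⟨Z, rfl⟩
    · exact ⟨0, Y, hYX, by simp⟩
    · obtain ⟨k, P, hP, rfl⟩ := ih ((List.prefix_append_right_inj X).1 h)
      exact ⟨k + 1, P, hP, by simp [List.replicate_succ]⟩

theorem exists_eq_pow_mul_of_commute {X Y : List (Σ i, M i)} (hne : X ≠ [])
    (hX : IsReduced (X ++ X)) (hYX : IsReduced (Y ++ X))
    (h : Commute (listProd X) (listProd Y)) :
    ∃ (k : ℕ) (P : List (Σ i, M i)), P <+: X ∧ listProd Y = listProd X ^ k * listProd P := by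
  set n := Y.length
  have heq : Y ++ (List.replicate n X).flatten = (List.replicate n X).flatten ++ Y :=
    (hX.append_flatten_replicate hYX n).eq_of_length_le
      (by simpa using ((h.pow_left n).eq).symm) (by simp [add_comm])
  have hlen : Y.length ≤ (List.replicate n X).flatten.length := by
    have : 0 < X.length := List.length_pos_iff.2 hne
    simp only [List.length_flatten, List.map_replicate, List.sum_replicate, smul_eq_mul]
    exact Nat.le_mul_of_pos_right _ this
  have hpre : Y <+: (List.replicate n X).flatten :=
    List.prefix_of_prefix_length_le ⟨_, heq⟩ (List.prefix_append _ _) hlen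
  obtain ⟨k, P, hP, hY⟩ := exists_of_prefix_flatten_replicate hpre
  exact ⟨k, P, hP, by rw [hY]; simp⟩

/-- The centralizer of the product of a cyclically reduced list is covered by finitely many cosets
of the cyclic subgroup it generates. -/
theorem exists_eq_zpow_mul_of_commute {X : List (Σ i, M i)} (hne : X ≠ [])
    (hX : IsReduced (X ++ X)) {y : CoprodI M} (h : Commute (listProd X) y) :
    ∃ (k : ℤ) (P : List (Σ i, M i)), P ∈ X.inits ++ (listInv X).inits ∧
      y = listProd X ^ k * listProd P := by
  obtain ⟨Y, hY, rfl⟩ := exists_isReduced_listProd_eq y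
  have hXred := (isReduced_append.1 hX).1
  by_cases hYX : IsReduced (Y ++ X)
  · obtain ⟨k, P, hP, heq⟩ := exists_eq_pow_mul_of_commute hne hX hYX h
    exact ⟨k, P, by simp [hP], by simpa using heq⟩
  · have hinv : listInv X ++ listInv X = listInv (X ++ X) := by simp [listInv]
    have hYinv : IsReduced (Y ++ listInv X) := by
      have hXX := (isReduced_append.1 hX).2.2
      simp only [isReduced_append, hY, hXred, true_and] at hYX
      push Not at hYX
      obtain ⟨s, hs, t, ht, hst⟩ := hYX
      refine isReduced_append.2 ⟨hY, hXred.listInv, ?_⟩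
      intro s' hs' t' ht'
      obtain rfl : s = s' := Option.mem_unique hs hs'
      simp only [listInv, List.head?_reverse, List.getLast?_map, Option.mem_def,
        Option.map_eq_some_iff] at ht'
      obtain ⟨u, hu, rfl⟩ := ht'
      rw [hst]
      exact (hXX u hu t ht).symm
    obtain ⟨k, P, hP, heq⟩ := exists_eq_pow_mul_of_commute (X := listInv X)
      (by simpa [listInv] using hne) (hinv ▸ hX.listInv) hYinv (by simpa using h.inv_left)
    exact ⟨-k, P, by simp [hP], by simpa using heq⟩

theorem pow_listProd_ne_one {X : List (Σ i, M i)} (hne : X ≠ []) (hX : IsReduced (X ++ X))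
    {n : ℕ} (hn : n ≠ 0) : listProd X ^ n ≠ 1 := by
  intro h
  have hred := hX.append_flatten_replicate (Y := []) (isReduced_append.1 hX).1 n
  have := hred.listProd_inj isReduced_nil (by simpa using h)
  obtain ⟨m, rfl⟩ := Nat.exists_eq_succ_of_ne_zero hn
  simp [List.replicate_succ, hne] at this

/-- Every nontrivial element of a free product is conjugate to an element of a factor or to the
product of a cyclically reduced list. -/
theorem exists_conj_of_or_cyclicallyReduced {x : CoprodI M} (hx : x ≠ 1) :
    ∃ g : CoprodI M, (∃ (i : ι) (a : M i), g * x * g⁻¹ = of a) ∨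
      ∃ X : List (Σ i, M i), X ≠ [] ∧ IsReduced (X ++ X) ∧ g * x * g⁻¹ = listProd X := by
  classical
  have hex : ∃ n, ∃ (L : List (Σ i, M i)) (g : CoprodI M),
      L.length = n ∧ g * x * g⁻¹ = listProd L := by
    obtain ⟨L, -, rfl⟩ := exists_isReduced_listProd_eq x
    exact ⟨_, L, 1, rfl, by simp⟩
  obtain ⟨L, g, hlen, hL⟩ := Nat.find_spec hex
  have hmin : ∀ (L' : List (Σ i, M i)) (g' : CoprodI M), g' * x * g'⁻¹ = listProd L' →
      L.length ≤ L'.length := fun L' g' h => hlen ▸ Nat.find_min' hex ⟨L', g', rfl, h⟩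
  have hred : IsReduced L := by
    obtain ⟨L', hred, hprod, rfl | hlt⟩ := exists_isReduced L
    · exact hred
    · exact absurd (hmin L' g (hL.trans hprod.symm)) (by lia)
  refine ⟨g, ?_⟩
  match L, hL, hmin, hred with
  | [], hL, _, _ => exact absurd (conj_eq_one_iff.1 hL) hx
  | s :: T, hL, hmin, hred =>
    rcases List.eq_nil_or_concat T with rfl | ⟨T, t, rfl⟩
    · exact Or.inl ⟨s.1, s.2, by simpa using hL⟩
    · refine Or.inr ⟨_, by simp, isReduced_append.2 ⟨hred, hred, ?_⟩, hL⟩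
      obtain ⟨i, a⟩ := s
      obtain ⟨j, b⟩ := t
      suffices j ≠ i by simpa [List.getLast?_cons] using this
      rintro rfl
      have := hmin (⟨j, b * a⟩ :: T) (of b * g) (by
        have : of b * g * x * (of b * g)⁻¹ = of b * (g * x * g⁻¹) * (of b)⁻¹ := by group
        rw [this, hL]
        simp [mul_assoc])
      simp at this

end Reduced

end Monoid.CoprodI

theorem GroupHasNoZeroDivisors.of_injective {K L : Type*} [Group K] [Group L]
    (hL : GroupHasNoZeroDivisors L) (f : K →* L) (hf : Function.Injective f) :
    GroupHasNoZeroDivisors K := by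
  rintro ⟨x, y, hx, hy, hxy, hcomm⟩
  refine hL ⟨f x, f y, (map_ne_one_iff f hf).2 hx, (map_ne_one_iff f hf).2 hy, ?_, hcomm.map f⟩
  rw [← MonoidHom.map_zpowers, ← MonoidHom.map_zpowers, ← Subgroup.map_inf _ _ f hf, hxy,
    Subgroup.map_bot]

namespace Monoid.CoprodI

variable {ι : Type*} {M : ι → Type*} [∀ i, Group (M i)]

theorem inf_zpowers_ne_bot_of_commute_of (hM : ∀ i, GroupHasNoZeroDivisors (M i))
    {i : ι} {a : M i} {g x y : CoprodI M} (hx : x ≠ 1) (hy : y ≠ 1) (h : Commute x y)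
    (hg : g * x * g⁻¹ = of a) : Subgroup.zpowers x ⊓ Subgroup.zpowers y ≠ ⊥ := by
  intro hbot
  have ha : a ≠ 1 := by
    rintro rfl
    exact hx (conj_eq_one_iff.1 (hg.trans (map_one _)))
  have hcomm : Commute (of a) (g * y * g⁻¹) := hg ▸ (Commute.conj_iff g).2 h
  obtain ⟨b, hb⟩ := mem_range_of_of_commute ha hcomm
  refine hM i ⟨a, b, ha, ?_, ?_, ?_⟩
  · rintro rfl
    exact hy (conj_eq_one_iff.1 (hb.trans (map_one _)))
  · apply Subgroup.map_injective (of_injective (M := M) i)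
    rw [Subgroup.map_inf _ _ _ (of_injective i), MonoidHom.map_zpowers, MonoidHom.map_zpowers,
      ← hg, ← hb, Subgroup.map_bot]
    have := congrArg (Subgroup.map (MulAut.conj g).toMonoidHom) hbot
    rw [Subgroup.map_inf _ _ _ (MulAut.conj g).injective, MonoidHom.map_zpowers,
      MonoidHom.map_zpowers, Subgroup.map_bot] at this
    simpa using this
  · apply of_injective (M := M) i
    rw [hb] at hcomm
    simpa using hcomm.eq

/-- If `x` is the product of a cyclically reduced list, then every element of the centralizer of `x`
has a positive power in the cyclic subgroup generated by `x`. -/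
theorem exists_pow_mem_zpowers_of_commute {X : List (Σ i, M i)} (hne : X ≠ [])
    (hX : IsReduced (X ++ X)) {y : CoprodI M} (h : Commute (listProd X) y) :
    ∃ n : ℕ, n ≠ 0 ∧ y ^ n ∈ Subgroup.zpowers (listProd X) := by
  choose k P hP hk using fun m : ℕ => exists_eq_zpow_mul_of_commute hne hX (h.pow_right m)
  let f : ℕ → {P // P ∈ X.inits ++ (listInv X).inits} := fun m => ⟨P m, hP m⟩
  have : Finite {P // P ∈ X.inits ++ (listInv X).inits} := List.finite_toSet _
  obtain ⟨m, m', hlt, hmm⟩ : ∃ m m', m < m' ∧ P m = P m' := by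
    obtain ⟨m, m', hne, heq⟩ := Finite.exists_ne_map_eq_of_infinite f
    have heq : P m = P m' := congrArg Subtype.val heq
    rcases hne.lt_or_gt with hlt | hlt
    exacts [⟨m, m', hlt, heq⟩, ⟨m', m, hlt, heq.symm⟩]
  refine ⟨m' - m, by lia, Subgroup.mem_zpowers_iff.2 ⟨k m' - k m, ?_⟩⟩
  rw [pow_sub _ hlt.le, hk m', hk m, hmm, zpow_sub]
  group

theorem groupHasNoZeroDivisors (hM : ∀ i, GroupHasNoZeroDivisors (M i)) :
    GroupHasNoZeroDivisors (CoprodI M) := by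
  rintro ⟨x, y, hx, hy, hbot, hcomm⟩
  obtain ⟨g, ⟨i, a, hg⟩ | ⟨X, hXne, hX, hg⟩⟩ := exists_conj_of_or_cyclicallyReduced hx
  · exact inf_zpowers_ne_bot_of_commute_of hM hx hy hcomm hg hbot
  obtain ⟨g', ⟨i, a, hg'⟩ | ⟨Y, hYne, hY, hg'⟩⟩ := exists_conj_of_or_cyclicallyReduced hy
  · exact inf_zpowers_ne_bot_of_commute_of hM hy hx hcomm.symm hg'
      ((inf_comm _ _).trans hbot)
  obtain ⟨n, hn, hmem⟩ := exists_pow_mem_zpowers_of_commute hXne hX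
    (hg ▸ (Commute.conj_iff g).2 hcomm)
  rw [← hg] at hmem
  obtain ⟨k, hk⟩ := Subgroup.mem_zpowers_iff.1 hmem
  rw [conj_zpow, conj_pow, mul_left_inj, mul_right_inj] at hk
  have hyn : y ^ n = 1 := by
    have : y ^ n ∈ Subgroup.zpowers x ⊓ Subgroup.zpowers y :=
      ⟨Subgroup.mem_zpowers_iff.2 ⟨k, hk⟩, Subgroup.npow_mem_zpowers y n⟩
    rwa [hbot, Subgroup.mem_bot] at this
  refine pow_listProd_ne_one hYne hY hn ?_
  rw [← hg', conj_pow, hyn, mul_one, mul_inv_cancel]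

end Monoid.CoprodI

namespace Monoid.Coprod

universe u v

/-- The two factors of a binary free product as a family indexed by `Bool`. -/
def factorFamily (G : Type u) (H : Type v) : Bool → Type (max u v)
  | true => ULift.{v} G
  | false => ULift.{u} H

instance factorFamilyGroup (G : Type u) (H : Type v) [Group G] [Group H] :
    (b : Bool) → Group (factorFamily G H b)
  | true => inferInstanceAs (Group (ULift.{v} G))
  | false => inferInstanceAs (Group (ULift.{u} H))

/-- The map from a binary free product to the corresponding indexed free product. -/
def toCoprodI (G : Type u) (H : Type v) [Group G] [Group H] :
    Monoid.Coprod G H →* Monoid.CoprodI (factorFamily G H) :=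
  Coprod.lift
    ((CoprodI.of (M := factorFamily G H) (i := true)).comp
      (MulEquiv.ulift (α := G)).symm.toMonoidHom)
    ((CoprodI.of (M := factorFamily G H) (i := false)).comp
      (MulEquiv.ulift (α := H)).symm.toMonoidHom)

theorem toCoprodI_injective (G : Type u) (H : Type v) [Group G] [Group H] :
    Function.Injective (toCoprodI G H) := by
  let f : (b : Bool) → factorFamily G H b →* Monoid.Coprod G H := fun
    | true => Coprod.inl.comp (MulEquiv.ulift (α := G)).toMonoidHom
    | false => Coprod.inr.comp (MulEquiv.ulift (α := H)).toMonoidHom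
  let inv : Monoid.CoprodI (factorFamily G H) →* Monoid.Coprod G H := CoprodI.lift f
  have h : inv.comp (toCoprodI G H) = MonoidHom.id _ := by
    apply Coprod.hom_ext
    · ext g
      exact CoprodI.lift_of f (i := true) (ULift.up g)
    · ext g
      exact CoprodI.lift_of f (i := false) (ULift.up g)
  exact Function.LeftInverse.injective (g := inv) (DFunLike.congr_fun h)

end Monoid.Coprod

theorem stmt_11 {G H : Type*} [Group G] [Group H]
    (hG : GroupHasNoZeroDivisors G) (hH : GroupHasNoZeroDivisors H) :
    GroupHasNoZeroDivisors (Monoid.Coprod G H) := by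
  refine GroupHasNoZeroDivisors.of_injective (Monoid.CoprodI.groupHasNoZeroDivisors ?_)
    (Monoid.Coprod.toCoprodI G H) (Monoid.Coprod.toCoprodI_injective G H)
  rintro (_ | _)
  · exact hH.of_injective (MulEquiv.ulift (α := H)).toMonoidHom MulEquiv.ulift.injective
  · exact hG.of_injective (MulEquiv.ulift (α := G)).toMonoidHom MulEquiv.ulift.injective
end
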